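/- Let E be a real Hilbert space, f: E → ℝ a smooth function, ψ: ℝ × E → E a negative gradient flow of f, and N ⊆ E compact. Suppose every critical point of f in N is nondegenerate, i.e., the Hessian of f there (the derivative of the map ∇f, a continuous linear map E → E) is invertible. If z ∈ E satisfies ψ(t,z) ∈ N for all t ≥ 0, then there exists a critical point x ∈ crit(f) ∩ N such that ψ(t,z) → x as t → +∞. -/

import Mathlib

open Set Filter

section GradientFlow

open Topology

variable {E : Type*} [NormedAddCommGroup E] [InnerProductSpace ℝ E] [CompleteSpace E]

theorem ContDiff.gradient {f : E → ℝ} {m n : WithTop ℕ∞} (hf : ContDiff ℝ n f)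
    (hmn : m + 1 ≤ n) : ContDiff ℝ m (gradient f) :=
  (InnerProductSpace.toDual ℝ E).symm.toContinuousLinearEquiv.contDiff.comp
    (hf.fderiv_right hmn)

theorem HasDerivAt.comp_neg_gradient {f : E → ℝ} (hf : Differentiable ℝ f) {u : ℝ → E} {t : ℝ}
    (hu : HasDerivAt u (-(gradient f (u t))) t) :
    HasDerivAt (fun s => f (u s)) (-‖gradient f (u t)‖ ^ 2) t := by
  have h := (hf (u t)).hasGradientAt.hasFDerivAt.comp_hasDerivAt t hu
  rw [map_neg, InnerProductSpace.toDual_apply_apply, real_inner_self_eq_norm_sq] at h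
  exact h

/-- Cluster points at `+∞` of a negative gradient trajectory whose forward half stays in a
compact set are critical points. -/
theorem MapClusterPt.gradient_eq_zero {f : E → ℝ} (hf : ContDiff ℝ 1 f) {u : ℝ → E}
    (hu : ∀ t, HasDerivAt u (-(gradient f (u t))) t) {N : Set E} (hN : IsCompact N)
    (huN : ∀ t, 0 ≤ t → u t ∈ N) {x : E} (hx : MapClusterPt x atTop u) :
    gradient f x = 0 := by
  have hg : Continuous (gradient f) := (hf.gradient (m := 0) (by simp)).continuous
  have hfu (t : ℝ) := (hu t).comp_neg_gradient (hf.differentiable (by simp))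
  obtain ⟨M, hM0, hM⟩ : ∃ M > 0, ∀ y ∈ N, ‖gradient f y‖ ≤ M := by
    obtain ⟨C, hC⟩ := hN.exists_bound_of_continuousOn hg.continuousOn
    exact ⟨max C 1, by positivity, fun y hy => (hC y hy).trans (le_max_left _ _)⟩
  have hlip {s t : ℝ} (hs : 0 ≤ s) (ht : 0 ≤ t) : dist (u t) (u s) ≤ M * |t - s| := by
    rw [dist_eq_norm]
    exact (convex_Ici (0 : ℝ)).norm_image_sub_le_of_norm_hasDerivWithin_le
      (fun r _ => (hu r).hasDerivWithinAt)
      (fun r hr => by simpa using hM _ (huN r hr)) hs ht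
  have hanti : Antitone fun s => f (u s) :=
    antitone_of_hasDerivAt_nonpos hfu fun t => by simp
  obtain ⟨m, hm⟩ := hN.bddBelow_image hf.continuous.continuousOn
  have hbdd : BddBelow (range fun s => f (u s)) := by
    refine ⟨m, ?_⟩
    rintro _ ⟨t, rfl⟩
    exact (hm ⟨_, huN _ (le_max_right t 0), rfl⟩).trans (hanti (le_max_left t 0))
  have hlim := tendsto_atTop_ciInf hanti hbdd
  by_contra hne
  set c := ‖gradient f x‖ / 2 with hc
  have hxpos : 0 < ‖gradient f x‖ := norm_pos_iff.2 hne
  have hc0 : 0 < c := by positivity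
  obtain ⟨r, hr, hball⟩ := Metric.eventually_nhds_iff.1
    (hg.norm.continuousAt.eventually (lt_mem_nhds (show c < ‖gradient f x‖ by linarith)))
  set δ := r / (2 * M) with hδ
  have hδ0 : 0 < δ := by positivity
  have hMδ : M * δ = r / 2 := by rw [hδ]; field_simp
  have hdiff : ∀ᶠ t in atTop, f (u t) - f (u (t + δ)) < c ^ 2 * δ := by
    have h := hlim.sub (hlim.comp (tendsto_atTop_add_const_right atTop δ tendsto_id))
    rw [sub_self] at h
    exact h.eventually (gt_mem_nhds (by positivity))
  obtain ⟨t, htx, hdt, ht0⟩ := ((hx.frequently (Metric.ball_mem_nhds x (half_pos hr))).and_eventually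
    (hdiff.and (eventually_ge_atTop 0))).exists
  obtain ⟨s, hs, hslope⟩ := exists_hasDerivAt_eq_slope (fun s => f (u s)) _
    (show t < t + δ by linarith) (fun s _ => (hfu s).continuousAt.continuousWithinAt)
    (fun s _ => hfu s)
  have hsx : dist (u s) x < r := by
    have h1 := hlip ht0 (ht0.trans hs.1.le)
    have h2 : M * |s - t| ≤ M * δ := by
      gcongr
      rw [abs_le]
      constructor <;> linarith [hs.1, hs.2]
    have h3 : dist (u t) x < r / 2 := htx
    linarith [dist_triangle (u s) (u t) x]
  have hgs : c < ‖gradient f (u s)‖ := hball hsx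
  rw [add_sub_cancel_left, eq_div_iff hδ0.ne'] at hslope
  have : c ^ 2 * δ ≤ ‖gradient f (u s)‖ ^ 2 * δ := by gcongr
  linarith

/-- A zero at which the derivative is bijective is isolated. -/
theorem HasFDerivAt.eventually_ne_of_bijective {g : E → E} {A : E →L[ℝ] E} {p c : E}
    (hg : HasFDerivAt g A p) (hA : Function.Bijective A) : ∀ᶠ y in 𝓝[≠] p, g y ≠ c := by
  refine hg.eventually_ne ?_
  let e := ContinuousLinearEquiv.ofBijective A (LinearMap.ker_eq_bot.2 hA.1)
    (LinearMap.range_eq_top.2 hA.2)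
  exact ⟨_, e.antilipschitz⟩

/-- A continuous curve staying in a compact set converges to any cluster point that is
isolated among its cluster points. -/
theorem MapClusterPt.tendsto_of_isolated {X : Type*} [MetricSpace X] {u : ℝ → X}
    (hu : Continuous u) {N : Set X} (hN : IsCompact N) (huN : ∀ t, 0 ≤ t → u t ∈ N) {x : X}
    (hx : MapClusterPt x atTop u) (hiso : ∀ᶠ y in 𝓝[≠] x, y ∈ N → ¬ MapClusterPt y atTop u) :
    Tendsto u atTop (𝓝 x) := by
  obtain ⟨r, hr, hball⟩ := Metric.eventually_nhds_iff.1 (eventually_nhdsWithin_iff.1 hiso)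
  rw [Metric.tendsto_nhds]
  by_contra! h
  obtain ⟨ε, hε, hfar⟩ := h
  have hfar' : ∃ᶠ t in atTop, ε ≤ dist (u t) x := by simpa [Filter.Frequently] using hfar
  set ρ := min ε r / 2 with hρ
  have hρ0 : 0 < ρ := by positivity
  have hρε : ρ ≤ ε := by linarith [min_le_left ε r]
  have hρr : ρ < r := by linarith [min_le_right ε r]
  have hsphere : ∃ᶠ t in atTop, u t ∈ N ∩ Metric.sphere x ρ := by
    rw [frequently_atTop]
    intro a
    obtain ⟨s, hs, hsx⟩ := frequently_atTop.1 (hx.frequently (Metric.ball_mem_nhds x hρ0)) (max a 0)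
    obtain ⟨t, ht, htx⟩ := frequently_atTop.1 hfar' s
    have hsx' : dist (u s) x < ρ := hsx
    obtain ⟨q, hq, hqx⟩ := intermediate_value_Icc ht
      (f := fun t => dist (u t) x) (by fun_prop) ⟨hsx'.le, hρε.trans htx⟩
    exact ⟨q, (le_max_left _ _).trans (hs.trans hq.1),
      huN q ((le_max_right _ _).trans (hs.trans hq.1)), hqx⟩
  obtain ⟨y, ⟨hyN, hyx⟩, hy⟩ := (hN.inter_right
    Metric.isClosed_sphere).exists_mapClusterPt_of_frequently hsphere
  have hyx' : dist y x = ρ := hyx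
  exact hball (hyx'.trans_lt hρr) (dist_pos.1 (hyx' ▸ hρ0)) hyN hy

end GradientFlow

/-- If all critical points of `f` in the compact set `N` are nondegenerate
(the Hessian, i.e. the derivative of `∇f`, is invertible there) and `z` has its forward
orbit under the negative gradient flow `ψ` contained in `N`, then `ψ (t, z)` converges, as
`t → +∞`, to some critical point `x ∈ crit(f) ∩ N`. -/
theorem statement11
    {E : Type*} [NormedAddCommGroup E] [InnerProductSpace ℝ E] [CompleteSpace E]
    (f : E → ℝ) (hfsmooth : ContDiff ℝ (⊤ : ℕ∞) f)
    (ψ : ℝ × E → E)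
    (hψ0 : ∀ x, ψ (0, x) = x)
    (hψgrp : ∀ t s x, ψ (t, ψ (s, x)) = ψ (t + s, x))
    (hψode : ∀ t x, HasDerivAt (fun s => ψ (s, x)) (-(gradient f (ψ (t, x)))) t)
    (N : Set E) (hNcpt : IsCompact N)
    (hnondeg : ∀ p ∈ {p | gradient f p = 0} ∩ N,
      Function.Bijective (fderiv ℝ (gradient f) p))
    (z : E) (hz : ∀ t : ℝ, 0 ≤ t → ψ (t, z) ∈ N) :
    ∃ x, gradient f x = 0 ∧ x ∈ N ∧
      Tendsto (fun t => ψ (t, z)) atTop (nhds x) := by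
  have hu (t : ℝ) : HasDerivAt (fun s => ψ (s, z)) (-(gradient f (ψ (t, z)))) t := hψode t z
  have hcont : Continuous fun t => ψ (t, z) :=
    continuous_iff_continuousAt.2 fun t => (hu t).continuousAt
  have hcrit {y : E} (hy : MapClusterPt y atTop fun t => ψ (t, z)) : gradient f y = 0 :=
    hy.gradient_eq_zero (hfsmooth.of_le (by exact_mod_cast le_top)) hu hNcpt hz
  obtain ⟨x, hxN, hx⟩ := hNcpt.exists_mapClusterPt_of_frequently (l := atTop)
    (f := fun t => ψ (t, z)) ((eventually_ge_atTop 0).mono hz).frequently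
  have hg : Differentiable ℝ (gradient f) :=
    (hfsmooth.gradient (m := 1) (WithTop.coe_le_coe.2 le_top)).differentiable (by simp)
  refine ⟨x, hcrit hx, hxN, hx.tendsto_of_isolated hcont hNcpt hz ?_⟩
  filter_upwards [(hg x).hasFDerivAt.eventually_ne_of_bijective (c := 0)
    (hnondeg x ⟨hcrit hx, hxN⟩)] with y hy _ hy'
  exact hy (hcrit hy')
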